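/- arXiv:1607.02066 — 6 statements merged into one kernel-verified Lean document; each statement's English description precedes it below -/
import Mathlib

section
/- Let V : ℕ × ℕ₀ → [0,∞), W : ℕ → (0,∞), U : ℕ₀ → (0,∞) satisfy W_1 = 1, U_0 = 1, V_{n,1} > 0 for every n ∈ ℕ, Σ_{j=0}^{∞} V_{1,j} = 1, and the consistency condition. Then there exist real numbers a > 0, b > 0 and τ ≥ 0 such that W_m = (a)_{m−1↑τ} for all m ∈ ℕ, U_m = (b)_{m↑τ} for all m ∈ ℕ₀, and for every n ∈ ℕ and k ∈ ℕ₀ the series converges and V_{n,k} = Σ_{j=0}^{∞} C(k+j, j) ((b)_{n↑τ})^j (a+b+τ(n−1))^k V_{n+1,k+j}. (Proposition 2.1, forward direction.) -/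
open scoped BigOperators

/-- Generalized rising factorial `(x)_{j↑τ} = x(x+τ)⋯(x+(j-1)τ)`. -/
noncomputable def risingFacTau (x τ : ℝ) (j : ℕ) : ℝ :=
  ∏ i ∈ Finset.range j, (x + i * τ)

/-- Consistency condition for the weights `V, W, U` of a product-form EFPF. -/
def Consistent (V : ℕ → ℕ → ℝ) (W U : ℕ → ℝ) : Prop :=
  ∀ n : ℕ, 1 ≤ n → ∀ k : ℕ, ∀ m : Fin k → ℕ,
    (∀ i, 1 ≤ m i ∧ m i ≤ n) →
    HasSum
      (fun j : ℕ =>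
        (Nat.choose (k + j) j : ℝ) * (U n) ^ j * (W 1) ^ j *
          ∑ z : Fin k → Fin 2,
            V (n + 1) (k + j) *
              ∏ i, W (m i + (z i : ℕ)) * U (n + 1 - m i - (z i : ℕ)))
      (V n k * ∏ i, W (m i) * U (n - m i))

/-- The consistency condition with all block sizes equal, divided by the common weight. -/
lemma Consistent.hasSum_const {V : ℕ → ℕ → ℝ} {W U : ℕ → ℝ} (h : Consistent V W U)
    (hWpos : ∀ m, 1 ≤ m → 0 < W m) (hUpos : ∀ m, 0 < U m) (hW1 : W 1 = 1)
    {n m : ℕ} (hm : 1 ≤ m) (hmn : m ≤ n) (k : ℕ) :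
    HasSum
      (fun j : ℕ => (Nat.choose (k + j) j : ℝ) * U n ^ j *
        (W (m + 1) / W m + U (n - m + 1) / U (n - m)) ^ k * V (n + 1) (k + j))
      (V n k) := by
  have hW := (hWpos m hm).ne'
  have hU := (hUpos (n - m)).ne'
  have key := (h n (hm.trans hmn) k (fun _ => m) (fun _ => ⟨hm, hmn⟩)).div_const
    ((W m * U (n - m)) ^ k)
  have hpow : (W m * U (n - m)) ^ k ≠ 0 := pow_ne_zero _ (mul_ne_zero hW hU)
  convert key using 1
  · rfl
  · funext j
    rw [← Finset.mul_sum,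
      ← Fintype.sum_pow (fun z : Fin 2 => W (m + (z : ℕ)) * U (n + 1 - m - (z : ℕ))) k,
      Fin.sum_univ_two]
    have h1 : n + 1 - m - 1 = n - m := by omega
    have h2 : n + 1 - m = n - m + 1 := by omega
    have h3 : W (m + 1) / W m + U (n - m + 1) / U (n - m) =
        (W m * U (n - m + 1) + W (m + 1) * U (n - m)) / (W m * U (n - m)) := by
      field_simp
      ring
    simp only [Fin.val_zero, Fin.val_one, h1, add_zero, Nat.sub_zero, hW1, one_pow, mul_one]
    rw [h2, h3, div_pow]
    ring
  · simp only [Finset.prod_const, Finset.card_univ, Fintype.card_fin]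
    field_simp

/-- The ratio sum in the consistency condition does not depend on the block size. -/
lemma Consistent.ratio_eq {V : ℕ → ℕ → ℝ} {W U : ℕ → ℝ} (h : Consistent V W U)
    (hWpos : ∀ m, 1 ≤ m → 0 < W m) (hUpos : ∀ m, 0 < U m) (hW1 : W 1 = 1)
    (hV1 : ∀ n, 1 ≤ n → 0 < V n 1) {n m l : ℕ} (hm : 1 ≤ m) (hmn : m ≤ n)
    (hl : 1 ≤ l) (hln : l ≤ n) :
    W (m + 1) / W m + U (n - m + 1) / U (n - m) =
      W (l + 1) / W l + U (n - l + 1) / U (n - l) := by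
  have pos : ∀ p, 1 ≤ p → 0 < W (p + 1) / W p + U (n - p + 1) / U (n - p) := fun p hp =>
    add_pos (div_pos (hWpos _ (by omega)) (hWpos _ hp)) (div_pos (hUpos _) (hUpos _))
  have key : ∀ p, 1 ≤ p → p ≤ n →
      HasSum (fun j : ℕ => (Nat.choose (1 + j) j : ℝ) * U n ^ j * V (n + 1) (1 + j))
        (V n 1 / (W (p + 1) / W p + U (n - p + 1) / U (n - p))) := fun p hp hpn => by
    have := (h.hasSum_const hWpos hUpos hW1 hp hpn 1).div_const
      (W (p + 1) / W p + U (n - p + 1) / U (n - p))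
    convert this using 1
    · rfl
    · funext j
      rw [pow_one, eq_div_iff (pos p hp).ne']
      ring
  have e := (key m hm hmn).unique (key l hl hln)
  rw [div_eq_div_iff (pos m hm).ne' (pos l hl).ne'] at e
  exact (mul_left_cancel₀ (hV1 n (hm.trans hmn)).ne' e).symm

/-- A sequence with affine successive ratios `x + iτ` starting at `1` is a rising factorial. -/
lemma eq_risingFacTau_of_ratio {f : ℕ → ℝ} {x τ : ℝ} (h0 : f 0 = 1) (hf : ∀ i, f i ≠ 0)
    (hratio : ∀ i : ℕ, f (i + 1) / f i = x + i * τ) (j : ℕ) : f j = risingFacTau x τ j := by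
  induction j with
  | zero => simp [risingFacTau, h0]
  | succ j ih =>
    rw [risingFacTau, Finset.prod_range_succ, ← risingFacTau, ← ih, ← hratio j,
      mul_div_cancel₀ _ (hf j)]

/-- The slope of an affine sequence of positive numbers is nonnegative. -/
lemma slope_nonneg_of_forall_pos {x τ : ℝ} (h : ∀ i : ℕ, 0 < x + i * τ) : 0 ≤ τ := by
  by_contra! hτ
  obtain ⟨n, hn⟩ := exists_nat_gt (x / -τ)
  rw [div_lt_iff₀ (neg_pos.mpr hτ)] at hn
  linarith [h n]

/-- Proposition 2.1, forward direction. -/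
theorem stmt_0
    (V : ℕ → ℕ → ℝ) (W U : ℕ → ℝ)
    (hVnonneg : ∀ n k, 1 ≤ n → 0 ≤ V n k)
    (hWpos : ∀ m, 1 ≤ m → 0 < W m)
    (hUpos : ∀ m, 0 < U m)
    (hW1 : W 1 = 1) (hU0 : U 0 = 1)
    (hV1 : ∀ n, 1 ≤ n → 0 < V n 1)
    (hVsum : HasSum (fun j => V 1 j) 1)
    (hcons : Consistent V W U) :
    ∃ a b τ : ℝ, 0 < a ∧ 0 < b ∧ 0 ≤ τ ∧
      (∀ m : ℕ, 1 ≤ m → W m = risingFacTau a τ (m - 1)) ∧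
      (∀ m : ℕ, U m = risingFacTau b τ m) ∧
      (∀ n : ℕ, 1 ≤ n → ∀ k : ℕ,
        HasSum
          (fun j : ℕ =>
            (Nat.choose (k + j) j : ℝ) * (risingFacTau b τ n) ^ j *
              (a + b + τ * ((n : ℝ) - 1)) ^ k * V (n + 1) (k + j))
          (V n k)) := by
  set w : ℕ → ℝ := fun i => W (i + 2) / W (i + 1) with hw
  set u : ℕ → ℝ := fun i => U (i + 1) / U i with hu
  have hwpos : ∀ i, 0 < w i := fun i => div_pos (hWpos _ (by omega)) (hWpos _ (by omega))
  have hupos : ∀ i, 0 < u i := fun i => div_pos (hUpos _) (hUpos _)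
  have exch : ∀ i j, w i + u j = w 0 + u (i + j) := fun i j => by
    have := hcons.ratio_eq hWpos hUpos hW1 hV1 (n := i + j + 1) (m := i + 1) (l := 1)
      (by omega) (by omega) (by omega) (by omega)
    rwa [show i + j + 1 - (i + 1) = j by omega, show i + j + 1 - 1 = i + j by omega] at this
  have hu_affine : ∀ i : ℕ, u i = u 0 + i * (w 1 - w 0) := fun i => by
    induction i with
    | zero => simp
    | succ i ih =>
      have := exch 1 i
      rw [add_comm 1 i] at this
      push_cast
      linarith
  have hw_affine : ∀ i : ℕ, w i = w 0 + i * (w 1 - w 0) := fun i => by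
    have := exch i 0
    rw [add_zero] at this
    linarith [hu_affine i]
  have hUeq : ∀ m, U m = risingFacTau (u 0) (w 1 - w 0) m :=
    eq_risingFacTau_of_ratio hU0 (fun i => (hUpos i).ne') hu_affine
  refine ⟨w 0, u 0, w 1 - w 0, hwpos 0, hupos 0,
    slope_nonneg_of_forall_pos fun i => hw_affine i ▸ hwpos i, fun m hm => ?_, hUeq,
    fun n hn k => ?_⟩
  · obtain ⟨i, rfl⟩ := Nat.exists_eq_add_of_le' hm
    exact eq_risingFacTau_of_ratio (f := fun i => W (i + 1)) hW1
      (fun i => (hWpos _ (by omega)).ne') hw_affine i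
  · obtain ⟨i, rfl⟩ := Nat.exists_eq_add_of_le' hn
    have key := hcons.hasSum_const hWpos hUpos hW1 le_rfl hn k
    have hc : W (1 + 1) / W 1 + U (i + 1 - 1 + 1) / U (i + 1 - 1) =
        w 0 + u 0 + (w 1 - w 0) * (((i + 1 : ℕ) : ℝ) - 1) := by
      have := hu_affine i
      push_cast
      change w 0 + u i = _
      linarith
    rwa [hc, hUeq (i + 1)] at key
end

section
/- Let a > 0, b > 0, τ ≥ 0 be real numbers, and define W_m = (a)_{m−1↑τ} for m ∈ ℕ and U_m = (b)_{m↑τ} for m ∈ ℕ₀. Let V : ℕ × ℕ₀ → [0,∞) be such that for every n ∈ ℕ and k ∈ ℕ₀ the series converges and V_{n,k} = Σ_{j=0}^{∞} C(k+j, j) ((b)_{n↑τ})^j (a+b+τ(n−1))^k V_{n+1,k+j}. Then V, W, U satisfy the consistency condition. (Proposition 2.1, converse direction.) -/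
open scoped BigOperators

lemma risingFacTau_succ (x τ : ℝ) (j : ℕ) :
    risingFacTau x τ (j + 1) = risingFacTau x τ j * (x + j * τ) :=
  Finset.prod_range_succ _ _

lemma sum_risingFacTau_mul_risingFacTau (a b τ : ℝ) {n m : ℕ} (hm : 1 ≤ m) (hmn : m ≤ n) :
    ∑ z : Fin 2, risingFacTau a τ (m + (z : ℕ) - 1) * risingFacTau b τ (n + 1 - m - (z : ℕ)) =
      risingFacTau a τ (m - 1) * risingFacTau b τ (n - m) * (a + b + τ * ((n : ℝ) - 1)) := by
  obtain ⟨p, rfl⟩ := Nat.exists_eq_add_of_le' hm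
  obtain ⟨q, rfl⟩ := Nat.exists_eq_add_of_le hmn
  have hq : p + 1 + q + 1 - (p + 1) = q + 1 := by omega
  rw [Fin.sum_univ_two, hq]
  simp only [Fin.val_zero, Fin.val_one, add_zero, Nat.sub_zero, Nat.add_sub_cancel,
    Nat.add_sub_cancel_left, risingFacTau_succ]
  push_cast
  ring

/-- Proposition 2.1, converse direction. -/
theorem stmt_1
    (a b τ : ℝ) (ha : 0 < a) (hb : 0 < b) (hτ : 0 ≤ τ)
    (V : ℕ → ℕ → ℝ) (hVnonneg : ∀ n k, 0 ≤ V n k)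
    (hrec : ∀ n : ℕ, 1 ≤ n → ∀ k : ℕ,
      HasSum
        (fun j : ℕ =>
          (Nat.choose (k + j) j : ℝ) * (risingFacTau b τ n) ^ j *
            (a + b + τ * ((n : ℝ) - 1)) ^ k * V (n + 1) (k + j))
        (V n k)) :
    Consistent V (fun m => risingFacTau a τ (m - 1)) (fun m => risingFacTau b τ m) := by
  intro n hn k m hm
  have hsum : ∑ z : Fin k → Fin 2, ∏ i, risingFacTau a τ (m i + (z i : ℕ) - 1) *
        risingFacTau b τ (n + 1 - m i - (z i : ℕ)) =
      (a + b + τ * ((n : ℝ) - 1)) ^ k *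
        ∏ i, risingFacTau a τ (m i - 1) * risingFacTau b τ (n - m i) := by
    rw [← Fintype.piFinset_univ, ← Finset.prod_univ_sum (fun _ => Finset.univ)
      (fun i (z : Fin 2) => risingFacTau a τ (m i + (z : ℕ) - 1) *
        risingFacTau b τ (n + 1 - m i - (z : ℕ)))]
    simp only [sum_risingFacTau_mul_risingFacTau a b τ (hm _).1 (hm _).2]
    rw [Finset.prod_mul_distrib, Finset.prod_const, Finset.card_univ, Fintype.card_fin, mul_comm]
  have hW : risingFacTau a τ (1 - 1) = 1 := Finset.prod_range_zero _
  have h := (hrec n hn k).mul_right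
    (∏ i, risingFacTau a τ (m i - 1) * risingFacTau b τ (n - m i))
  refine Eq.mp (congrArg (HasSum · _) (funext fun j => ?_)) h
  rw [← Finset.mul_sum, hsum]
  beta_reduce
  rw [hW]
  ring
end

section
/- Let W : ℕ → (0,∞) and U : ℕ₀ → (0,∞) satisfy W_1 = 1 and U_0 = 1, and suppose that for every n ∈ ℕ there is a constant c_n ∈ ℝ such that W_{m+1}/W_m + U_{n+1−m}/U_{n−m} = c_n for all integers m with 1 ≤ m ≤ n. Set τ := U_2/U_1 − U_1. Then τ = W_3/W_2 − W_2, τ ≥ 0, and for all m, W_m = (W_2)_{m−1↑τ} and U_m = (U_1)_{m↑τ}. (Intermediate rigidity lemma in the proof of Proposition 2.1.) -/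
open scoped BigOperators

theorem eq_risingFacTau_of_ratio_succ {V : ℕ → ℝ} {x τ : ℝ} (h0 : V 0 = 1)
    (hV : ∀ k, V k ≠ 0) (hratio : ∀ k : ℕ, V (k + 1) / V k = x + k * τ) (k : ℕ) :
    V k = risingFacTau x τ k := by
  induction k with
  | zero => simp [risingFacTau, h0]
  | succ k ih =>
    rw [(div_eq_iff (hV k)).mp (hratio k), ih, risingFacTau, risingFacTau,
      Finset.prod_range_succ, mul_comm]

theorem nonneg_of_forall_add_natCast_mul_pos {x τ : ℝ} (h : ∀ k : ℕ, 0 < x + k * τ) : 0 ≤ τ := by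
  by_contra! hτ
  obtain ⟨k, hk⟩ := exists_nat_gt (x / -τ)
  rw [div_lt_iff₀ (by linarith)] at hk
  linarith [h k]

/-- Intermediate rigidity lemma in the proof of Proposition 2.1. -/
theorem stmt_3
    (W U : ℕ → ℝ)
    (hWpos : ∀ m, 1 ≤ m → 0 < W m)
    (hUpos : ∀ m, 0 < U m)
    (hW1 : W 1 = 1) (hU0 : U 0 = 1)
    (hconst : ∀ n : ℕ, 1 ≤ n → ∃ c : ℝ, ∀ m : ℕ, 1 ≤ m → m ≤ n →
      W (m + 1) / W m + U (n + 1 - m) / U (n - m) = c) :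
    U 2 / U 1 - U 1 = W 3 / W 2 - W 2 ∧
    0 ≤ U 2 / U 1 - U 1 ∧
    (∀ m : ℕ, 1 ≤ m → W m = risingFacTau (W 2) (U 2 / U 1 - U 1) (m - 1)) ∧
    (∀ m : ℕ, U m = risingFacTau (U 1) (U 2 / U 1 - U 1) m) := by
  set τ := U 2 / U 1 - U 1 with hτ
  have cross (m k : ℕ) : W (m + 3) / W (m + 2) + U (k + 1) / U k =
      W (m + 2) / W (m + 1) + U (k + 2) / U (k + 1) := by
    obtain ⟨c, hc⟩ := hconst (m + k + 2) (by omega)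
    have h₁ := hc (m + 2) (by omega) (by omega)
    have h₂ := hc (m + 1) (by omega) (by omega)
    rw [show m + k + 2 + 1 - (m + 2) = k + 1 by omega,
      show m + k + 2 - (m + 2) = k by omega] at h₁
    rw [show m + k + 2 + 1 - (m + 1) = k + 2 by omega,
      show m + k + 2 - (m + 1) = k + 1 by omega] at h₂
    exact h₁.trans h₂.symm
  have ratioW (m : ℕ) : W (m + 2) / W (m + 1) = W 2 + m * τ := by
    induction m with
    | zero => simp [hW1]
    | succ m ih =>
      have h := cross m 0
      simp only [zero_add, hU0, div_one] at h
      push_cast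
      linarith
  have ratioU (k : ℕ) : U (k + 1) / U k = U 1 + k * τ := by
    induction k with
    | zero => simp [hU0]
    | succ k ih =>
      have h := cross 0 k
      have h' := ratioW 1
      have h'' := ratioW 0
      norm_num at h h' h''
      push_cast
      linarith
  refine ⟨?_, ?_, fun m hm => ?_, ?_⟩
  · have h := ratioW 1
    norm_num at h
    linarith
  · refine nonneg_of_forall_add_natCast_mul_pos (x := U 1) fun k => ?_
    rw [← ratioU]
    exact div_pos (hUpos _) (hUpos _)
  · obtain ⟨m, rfl⟩ := Nat.exists_eq_add_of_le' hm
    exact eq_risingFacTau_of_ratio_succ (V := fun k => W (k + 1)) hW1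
      (fun k => (hWpos _ (by omega)).ne') ratioW m
  · exact eq_risingFacTau_of_ratio_succ hU0 (fun k => (hUpos k).ne') ratioU
end

section
/- Fix real numbers α and θ with 0 < α < 1 and θ > −α. A map V : ℕ × ℕ₀ → [0,∞) is an (α,θ)-solution if and only if there exists a Borel probability measure μ on [0,∞) such that V_{n,k} = ∫_{[0,∞)} V^{IBP,α,θ}_{n,k}(γ) μ(dγ) for all n ∈ ℕ and k ∈ ℕ₀. (Theorem 1.1, case 0 < α < 1: the solutions are exactly the mixtures over γ of the three-parameter Indian Buffet Process weights.) -/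
open scoped BigOperators
open MeasureTheory

/-- Rising factorial `(x)_{j↑} = x(x+1)⋯(x+j-1)`. -/
noncomputable def risingFac (x : ℝ) (j : ℕ) : ℝ :=
  ∏ i ∈ Finset.range j, (x + i)

/-- `V` is an `(α,θ)`-solution of the consistency recursion. -/
def IsSolution (α θ : ℝ) (V : ℕ → ℕ → ℝ) : Prop :=
  HasSum (fun j => V 1 j) 1 ∧
  ∀ n : ℕ, 1 ≤ n → ∀ k : ℕ,
    HasSum
      (fun j : ℕ =>
        (Nat.choose (k + j) j : ℝ) * (risingFac (θ + α) n) ^ j *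
          (θ + (n : ℝ)) ^ k * V (n + 1) (k + j))
      (V n k)

/-- Indian Buffet Process weights `V^{IBP,α,θ}_{n,k}(γ)`. -/
noncomputable def VIBP (α θ γ : ℝ) (n k : ℕ) : ℝ :=
  (1 / (Nat.factorial k : ℝ)) * (γ / risingFac (θ + 1) (n - 1)) ^ k *
    Real.exp (-(∑ i ∈ Finset.Icc 1 n,
      γ * risingFac (α + θ) (i - 1) / risingFac (1 + θ) (i - 1)))


open Filter Topology Set
open scoped Nat unitInterval

/-- Monotone-convergence form of termwise integration for series of nonnegative functions. -/
lemma hasSum_integral_of_ae_nonneg {X : Type*} [MeasurableSpace X] {μ : Measure X}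
    {g : ℕ → X → ℝ} {h : X → ℝ} (hg : ∀ j, AEStronglyMeasurable (g j) μ)
    (hg0 : ∀ᵐ x ∂μ, ∀ j, 0 ≤ g j x) (hh : Integrable h μ)
    (hsum : ∀ᵐ x ∂μ, HasSum (fun j => g j x) (h x)) :
    HasSum (fun j => ∫ x, g j x ∂μ) (∫ x, h x ∂μ) := by
  have hint : ∀ j, Integrable (g j) μ := fun j => by
    refine hh.mono' (hg j) ?_
    filter_upwards [hg0, hsum] with x hx hs
    rw [Real.norm_of_nonneg (hx j)]
    exact le_hasSum hs j fun i _ => hx i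
  have hnorm : ∀ j, ∫ x, ‖g j x‖ ∂μ = ∫ x, g j x ∂μ := fun j =>
    integral_congr_ae (by filter_upwards [hg0] with x hx using Real.norm_of_nonneg (hx j))
  have hsummable : Summable fun j => ∫ x, ‖g j x‖ ∂μ := by
    refine summable_of_sum_le (c := ∫ x, h x ∂μ)
      (fun j => integral_nonneg fun x => norm_nonneg _) fun s => ?_
    simp_rw [hnorm]
    rw [← integral_finsetSum _ fun i _ => hint i]
    refine integral_mono_ae (integrable_finsetSum _ fun i _ => hint i) hh ?_
    filter_upwards [hg0, hsum] with x hx hs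
    exact sum_le_hasSum s (fun i _ => hx i) hs
  have key := hasSum_integral_of_summable_integral_norm hint hsummable
  rwa [integral_congr_ae (by filter_upwards [hsum] with x hs using hs.tsum_eq)] at key

/-- A power series that vanishes on a right neighbourhood of `0` has zero coefficients. -/
lemma eq_zero_of_hasSum_mul_pow_zero {r : ℝ} (hr : 0 < r) (c : ℕ → ℝ)
    (h : ∀ t ∈ Ioo 0 r, HasSum (fun j => c j * t ^ j) 0) (k : ℕ) : c k = 0 := by
  have head : ∀ c : ℕ → ℝ, (∀ t ∈ Ioo 0 r, HasSum (fun j => c j * t ^ j) 0) → c 0 = 0 := by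
    intro c h
    have hlim : Tendsto (fun t : ℝ => ∑' j, c j * t ^ j) (𝓝[>] 0) (𝓝 (∑' j, c j * 0 ^ j)) := by
      refine tendsto_tsum_of_dominated_convergence (bound := fun j => ‖c j * (r / 2) ^ j‖)
        (h (r / 2) ⟨by positivity, by linarith⟩).summable.norm (fun j => ?_) ?_
      · exact (Continuous.tendsto (by fun_prop) 0).mono_left nhdsWithin_le_nhds
      · filter_upwards [Ioo_mem_nhdsGT (half_pos hr)] with t ht j
        rw [norm_mul, norm_mul, norm_pow, norm_pow, Real.norm_of_nonneg ht.1.le,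
          Real.norm_of_nonneg (half_pos hr).le]
        have := pow_le_pow_left₀ ht.1.le ht.2.le j
        gcongr
    have hzero : Tendsto (fun t : ℝ => ∑' j, c j * t ^ j) (𝓝[>] 0) (𝓝 0) := by
      refine tendsto_const_nhds.congr' ?_
      filter_upwards [Ioo_mem_nhdsGT hr] with t ht using (h t ht).tsum_eq.symm
    rw [← tendsto_nhds_unique hlim hzero, tsum_eq_single 0]
    · simp
    · intro j hj
      simp [hj]
  induction k generalizing c with
  | zero => exact head c h
  | succ k ih =>
    refine ih (fun j => c (j + 1)) fun t ht => ?_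
    have h1 := (hasSum_nat_add_iff' (f := fun j => c j * t ^ j) 1).2 (h t ht)
    have h2 := h1.mul_left t⁻¹
    simp only [Finset.range_one, Finset.sum_singleton, head c h, zero_mul, sub_zero,
      mul_zero] at h2
    refine h2.congr_fun fun j => ?_
    rw [pow_succ]
    have := mul_inv_cancel₀ ht.1.ne'
    linear_combination (-c (j + 1) * t ^ j) * this

/-- A discrete probability distribution placed on points of `[0,1]`. -/
lemma exists_probabilityMeasure_hasSum {p : ℕ → ℝ} (hp0 : ∀ l, 0 ≤ p l) (hp : HasSum p 1)
    (x : ℕ → I) : ∃ ν : ProbabilityMeasure I, ∀ g : C(I, ℝ),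
      HasSum (fun l => p l * g (x l)) (∫ y, g y ∂(ν : Measure I)) := by
  set m : Measure I := Measure.sum fun l => ENNReal.ofReal (p l) • Measure.dirac (x l) with hm
  have hprob : IsProbabilityMeasure m := by
    constructor
    rw [hm, Measure.sum_apply _ MeasurableSet.univ]
    simp [← ENNReal.ofReal_tsum_of_nonneg hp0 hp.summable, hp.tsum_eq]
  refine ⟨⟨m, hprob⟩, fun g => ?_⟩
  have hint : Integrable g m := by
    refine Integrable.of_bound g.continuous.aestronglyMeasurable ‖g‖ (.of_forall g.norm_coe_le_norm)
  have := hasSum_integral_measure hint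
  simpa [integral_smul_measure, ENNReal.toReal_ofReal, hp0] using this

/-- The scaled exponential is uniformly close to the scaled binomial factor. -/
lemma abs_exp_neg_mul_sub_one_sub_pow_le {u : ℝ} (hu0 : 0 ≤ u) (hu1 : u ≤ 1) (l : ℕ) :
    |Real.exp (-(u * l)) - (1 - u) ^ l| ≤ u * Real.exp u := by
  have h1 : 1 - u ≤ Real.exp (-u) := by linarith [Real.add_one_le_exp (-u)]
  have h2 : Real.exp (-u) - (1 - u) ≤ u ^ 2 := by
    have := Real.abs_exp_sub_one_sub_id_le (x := -u) (by rw [abs_neg, abs_of_nonneg hu0]; exact hu1)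
    rw [abs_le] at this
    nlinarith [this.2]
  have hpow : Real.exp (-(u * l)) = Real.exp (-u) ^ l := by
    rw [← Real.exp_nat_mul]; ring_nf
  have h3 : (1 - u) ^ l ≤ Real.exp (-u) ^ l := pow_le_pow_left₀ (by linarith) h1 l
  rw [hpow, abs_of_nonneg (by linarith)]
  rcases l with _ | l
  · simp; positivity
  have h4 : Real.exp (-u) ^ (l + 1) - (1 - u) ^ (l + 1) ≤
      (l + 1) * Real.exp (-u) ^ l * (Real.exp (-u) - (1 - u)) := by
    have hb : 0 ≤ 1 - u := by linarith
    have := (le_abs_self _).trans (abs_pow_sub_pow_le (Real.exp (-u)) (1 - u) (l + 1))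
    rw [abs_of_nonneg (sub_nonneg.2 h1), abs_of_nonneg (Real.exp_pos _).le, abs_of_nonneg hb,
      max_eq_left h1] at this
    push_cast at this
    simpa [mul_comm, mul_left_comm, mul_assoc] using this
  have h5 : (l + 1) * u * Real.exp (-u) ^ (l + 1) ≤ 1 := by
    rw [← Real.exp_nat_mul, ← le_div_iff₀ (Real.exp_pos _), one_div, ← Real.exp_neg]
    have := Real.add_one_le_exp ((l + 1) * u)
    push_cast
    ring_nf at this ⊢
    linarith
  calc _ ≤ _ := h4
    _ ≤ (l + 1) * Real.exp (-u) ^ l * u ^ 2 := by gcongr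
    _ = ((l + 1) * u * Real.exp (-u) ^ (l + 1)) * (u * Real.exp u) := by
      have : Real.exp (-u) * Real.exp u = 1 := by rw [← Real.exp_add]; simp
      rw [pow_succ]
      linear_combination (-(l + 1) * u ^ 2 * Real.exp (-u) ^ l) * this
    _ ≤ 1 * (u * Real.exp u) := by gcongr
    _ = _ := one_mul _

/-- Composition of two Taylor shifts of a nonnegative sequence. -/
lemma hasSum_taylor_shift {u v : ℕ → ℝ} {d t a : ℝ} (hd : 0 ≤ d) (ht : 0 ≤ t)
    (hv : ∀ j, 0 ≤ v j) (huv : ∀ k, HasSum (fun j => d ^ j / j ! * v (k + j)) (u k))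
    (hu : HasSum (fun k => t ^ k / k ! * u k) a) :
    HasSum (fun l => (t + d) ^ l / l ! * v l) a := by
  set f : ℕ × ℕ → ℝ := fun q => t ^ q.1 / q.1 ! * (d ^ q.2 / q.2 ! * v (q.1 + q.2)) with hf
  have hrow : ∀ k, HasSum (fun j => f (k, j)) (t ^ k / k ! * u k) := fun k => (huv k).mul_left _
  have hf0 : 0 ≤ f := fun q => by have := hv (q.1 + q.2); simp only [hf, Pi.zero_apply]; positivity
  have hs : Summable f := (summable_prod_of_nonneg hf0).2
    ⟨fun k => (hrow k).summable, by simpa only [(hrow _).tsum_eq] using hu.summable⟩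
  have hfa : HasSum f a := by
    rw [← (hs.hasSum.prod_fiberwise hrow).unique hu]
    exact hs.hasSum
  have hsig := ((Equiv.hasSum_iff Finset.HasAntidiagonal.sigmaAntidiagonalEquivProd).2 hfa).sigma
    (fun l => hasSum_fintype _)
  convert hsig using 2 with l
  change _ = ∑ b : Finset.HasAntidiagonal.antidiagonal l, f b.1
  rw [Finset.sum_coe_sort (Finset.HasAntidiagonal.antidiagonal l) f, (Commute.all t d).add_pow', Finset.sum_div,
    Finset.sum_mul]
  refine Finset.sum_congr rfl fun q hq => ?_
  rw [Finset.HasAntidiagonal.mem_antidiagonal] at hq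
  subst hq
  rw [hf, nsmul_eq_mul, Nat.cast_add_choose]
  have := Nat.factorial_ne_zero (q.1 + q.2)
  field_simp

/-- Representation of the values `∑ t ^ j / j! * U n j` of a completely monotone array as moments
of a single probability measure on `[0,1]`. -/
lemma exists_probabilityMeasure_rpow {S : ℕ → ℝ} {U : ℕ → ℕ → ℝ} (hS : Monotone S)
    (hSpos : ∀ n, 0 < S n) (hSlim : Tendsto S atTop atTop) (hU : ∀ n k, 0 ≤ U n k)
    (hone : HasSum (fun l => S 0 ^ l / l ! * U 0 l) 1)
    (hrec : ∀ n k, HasSum (fun j => (S (n + 1) - S n) ^ j / j ! * U (n + 1) (k + j)) (U n k)) :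
    ∃ ν : ProbabilityMeasure I, ∀ n, ∀ t ∈ Ico 0 (S n),
      HasSum (fun l => t ^ l / l ! * U n l) (∫ y : I, (y : ℝ) ^ (S n - t) ∂(ν : Measure I)) := by
  have shift : ∀ n t a, 0 ≤ t → HasSum (fun l => t ^ l / l ! * U n l) a →
      ∀ m, n ≤ m → HasSum (fun l => (S m - (S n - t)) ^ l / l ! * U m l) a := by
    intro n t a ht ha m hm
    induction m, hm using Nat.le_induction with
    | base => simpa using ha
    | succ m hm ih =>
      have := hasSum_taylor_shift (sub_nonneg.2 (hS m.le_succ))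
        (by linarith [hS hm] : 0 ≤ S m - (S n - t)) (hU (m + 1)) (hrec m) ih
      convert this using 5
      ring
  have hmass : ∀ m, HasSum (fun l => S m ^ l / l ! * U m l) 1 := fun m => by
    simpa using shift 0 (S 0) 1 (hSpos 0).le hone m m.zero_le
  have hmass0 : ∀ m l, 0 ≤ S m ^ l / l ! * U m l := fun m l => by
    have := hU m l
    have := hSpos m
    positivity
  let x : ℕ → ℕ → I := fun m l => ⟨Real.exp (-(l / S m)), (Real.exp_pos _).le,
    Real.exp_le_one_iff.2 (by have := hSpos m; simp; positivity)⟩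
  choose ν hν using fun m => exists_probabilityMeasure_hasSum (hmass0 m) (hmass m) (x m)
  obtain ⟨ν', -, hν'⟩ := isCompact_univ.ultrafilter_le_nhds
    ((Ultrafilter.of (atTop : Filter ℕ)).map ν) (by simp)
  refine ⟨ν', fun n t ht => ?_⟩
  set s := S n - t with hs
  have hs0 : 0 < s := sub_pos.2 ht.2
  have hsum : Summable fun l => t ^ l / l ! * U n l := by
    refine (hmass n).summable.of_nonneg_of_le (fun l => ?_) (fun l => ?_)
    · have := hU n l
      have := ht.1
      positivity
    · have := hU n l
      have := pow_le_pow_left₀ ht.1 ht.2.le l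
      gcongr
  obtain ⟨a, ha⟩ := hsum
  let g : C(I, ℝ) := ⟨fun y => (y : ℝ) ^ s,
    Continuous.rpow_const continuous_subtype_val fun _ => Or.inr hs0.le⟩
  have hclose : ∀ m, n ≤ m →
      |∫ y, g y ∂(ν m : Measure I) - a| ≤ s / S m * Real.exp (s / S m) := by
    intro m hm
    have hSm := hSpos m
    have hsm : s ≤ S m := by linarith [hS hm, ht.1]
    have h1 := (hν m g).sub (shift n t a ht.1 ha m hm)
    have h2 := (hmass m).mul_right (s / S m * Real.exp (s / S m))
    rw [one_mul] at h2
    rw [← Real.norm_eq_abs]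
    refine h1.norm_le_of_bounded h2 fun l => ?_
    have hfac : S m ^ l / l ! * U m l * g (x m l) - (S m - s) ^ l / l ! * U m l =
        S m ^ l / l ! * U m l * (Real.exp (-(s / S m * l)) - (1 - s / S m) ^ l) := by
      have hg : g (x m l) = Real.exp (-(s / S m * l)) := by
        change Real.exp (-(l / S m)) ^ s = _
        rw [← Real.exp_mul]
        ring_nf
      have hp : (S m - s) ^ l = S m ^ l * (1 - s / S m) ^ l := by
        rw [← mul_pow, mul_sub, mul_one, mul_div_cancel₀ _ hSm.ne']
      rw [hg, hp]
      ring
    rw [← hs, hfac, Real.norm_eq_abs, abs_mul, abs_of_nonneg (hmass0 m l)]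
    exact mul_le_mul_of_nonneg_left (abs_exp_neg_mul_sub_one_sub_pow_le (by positivity)
      ((div_le_one hSm).2 hsm) l) (hmass0 m l)
  have hbound : Tendsto (fun m => s / S m * Real.exp (s / S m)) atTop (𝓝 0) := by
    have h0 : Tendsto (fun m => s / S m) atTop (𝓝 0) := hSlim.const_div_atTop s
    simpa using h0.mul (Real.continuous_exp.tendsto 0 |>.comp h0)
  have hlim : Tendsto (fun m => ∫ y, g y ∂(ν m : Measure I)) atTop (𝓝 a) := by
    rw [tendsto_iff_norm_sub_tendsto_zero]
    refine squeeze_zero' (.of_forall fun _ => norm_nonneg _) ?_ hbound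
    filter_upwards [eventually_ge_atTop n] with m hm using hclose m hm
  have hlim' := (ProbabilityMeasure.tendsto_iff_forall_integral_tendsto (μs := ν)
    (F := (Ultrafilter.of (atTop : Filter ℕ) : Filter ℕ))).1 hν'
    (BoundedContinuousFunction.mkOfCompact g)
  have := tendsto_nhds_unique hlim' (hlim.mono_left (Ultrafilter.of_le _))
  rw [← this] at ha
  exact ha

/-- Discrete Bernstein theorem: a completely monotone array sampled at the points `S n` consists of
the derivatives of the Laplace transform of a probability measure on `[0,∞)`. -/
lemma exists_measure_eq_integral_pow_mul_exp {S : ℕ → ℝ} {U : ℕ → ℕ → ℝ} (hS : Monotone S)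
    (hSpos : ∀ n, 0 < S n) (hSlim : Tendsto S atTop atTop) (hU : ∀ n k, 0 ≤ U n k)
    (hone : HasSum (fun l => S 0 ^ l / l ! * U 0 l) 1)
    (hrec : ∀ n k, HasSum (fun j => (S (n + 1) - S n) ^ j / j ! * U (n + 1) (k + j)) (U n k)) :
    ∃ μ : Measure ℝ, IsProbabilityMeasure μ ∧ μ (Iio 0) = 0 ∧
      ∀ n k, U n k = ∫ γ, γ ^ k * Real.exp (-(γ * S n)) ∂μ := by
  obtain ⟨ν, hν⟩ := exists_probabilityMeasure_rpow hS hSpos hSlim hU hone hrec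
  have hpos : ∀ᵐ y : I ∂(ν : Measure I), 0 < (y : ℝ) := by
    have hlim : Tendsto (fun t => ∫ y : I, (y : ℝ) ^ (S 0 - t) ∂(ν : Measure I)) (𝓝[<] (S 0))
        (𝓝 (∫ y : I, ({0}ᶜ : Set I).indicator 1 y ∂(ν : Measure I))) := by
      have hnear : ∀ᶠ t in 𝓝[<] (S 0), 0 < S 0 - t := by
        filter_upwards [self_mem_nhdsWithin] with t ht using sub_pos.2 ht
      refine tendsto_integral_filter_of_dominated_convergence (fun _ => 1) ?_ ?_
        (integrable_const 1) (.of_forall fun y => ?_)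
      · filter_upwards [hnear] with t ht
        exact (Continuous.rpow_const continuous_subtype_val
          fun _ => Or.inr ht.le).aestronglyMeasurable
      · filter_upwards [hnear] with t ht
        refine .of_forall fun y => ?_
        rw [Real.norm_of_nonneg (Real.rpow_nonneg y.2.1 _)]
        exact Real.rpow_le_one y.2.1 y.2.2 ht.le
      · by_cases hy : y = 0
        · subst hy
          refine tendsto_const_nhds.congr' ?_
          filter_upwards [hnear] with t ht
          simp [Real.zero_rpow ht.ne']
        · have hy' : (y : ℝ) ≠ 0 := fun h => hy (Subtype.ext h)
          have hcont : ContinuousAt (fun t => (y : ℝ) ^ (S 0 - t)) (S 0) :=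
            ContinuousAt.rpow continuousAt_const (continuousAt_const.sub continuousAt_id) (Or.inl hy')
          simpa [hy] using hcont.tendsto.mono_left nhdsWithin_le_nhds
    have hlim' : Tendsto (fun t => ∫ y : I, (y : ℝ) ^ (S 0 - t) ∂(ν : Measure I)) (𝓝[<] (S 0))
        (𝓝 1) := by
      have hdom : Tendsto (fun t : ℝ => ∑' l, t ^ l / l ! * U 0 l) (𝓝[<] (S 0))
          (𝓝 (∑' l, S 0 ^ l / l ! * U 0 l)) := by
        refine tendsto_tsum_of_dominated_convergence (bound := fun l => S 0 ^ l / l ! * U 0 l)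
          hone.summable (fun l => ?_) ?_
        · exact (Continuous.tendsto (by fun_prop) (S 0)).mono_left nhdsWithin_le_nhds
        · filter_upwards [Ioo_mem_nhdsLT (hSpos 0)] with t ht l
          have h0 := hU 0 l
          have h1 := pow_le_pow_left₀ ht.1.le ht.2.le l
          have h2 := ht.1
          rw [Real.norm_of_nonneg (by positivity)]
          gcongr
      rw [hone.tsum_eq] at hdom
      refine hdom.congr' ?_
      filter_upwards [Ioo_mem_nhdsLT (hSpos 0)] with t ht
      exact (hν 0 t ⟨ht.1.le, ht.2⟩).tsum_eq
    have hmass := tendsto_nhds_unique hlim hlim'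
    rw [integral_indicator_one (measurableSet_singleton 0).compl] at hmass
    have hae : ∀ᵐ y : I ∂(ν : Measure I), y ∈ ({0}ᶜ : Set I) := by
      refine (mem_ae_iff_prob_eq_one (measurableSet_singleton 0).compl).2 ?_
      rwa [measureReal_def, ENNReal.toReal_eq_one_iff] at hmass
    filter_upwards [hae] with y hy
    exact lt_of_le_of_ne y.2.1 fun h => hy (Subtype.ext h.symm)
  have hmeas : Measurable fun y : I => -Real.log y :=
    (Real.measurable_log.comp measurable_subtype_coe).neg
  set μ : Measure ℝ := (ν : Measure I).map fun y : I => -Real.log y with hμ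
  have hprob : IsProbabilityMeasure μ := Measure.isProbabilityMeasure_map hmeas.aemeasurable
  have hIio : μ (Iio 0) = 0 := by
    rw [hμ, Measure.map_apply hmeas measurableSet_Iio]
    convert measure_empty (μ := (ν : Measure I))
    ext y
    simpa using Real.log_nonpos y.2.1 y.2.2
  have hnonneg : ∀ᵐ γ ∂μ, 0 ≤ γ := by
    rw [ae_iff]
    simpa [Iio] using hIio
  have hlaplace : ∀ s, ∫ y : I, (y : ℝ) ^ s ∂(ν : Measure I) = ∫ γ, Real.exp (-(γ * s)) ∂μ := by
    intro s
    rw [hμ, integral_map hmeas.aemeasurable (by fun_prop)]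
    refine integral_congr_ae ?_
    filter_upwards [hpos] with y hy
    rw [Real.rpow_def_of_pos hy]
    ring_nf
  refine ⟨μ, hprob, hIio, fun n k => ?_⟩
  have hzero := eq_zero_of_hasSum_mul_pow_zero (hSpos n)
    (fun l => (U n l - ∫ γ, γ ^ l * Real.exp (-(γ * S n)) ∂μ) / l !) (fun t ht => ?_) k
  · rw [div_eq_zero_iff, or_iff_left (by positivity), sub_eq_zero] at hzero
    exact hzero
  have hexp : HasSum (fun l => ∫ γ, t ^ l / l ! * (γ ^ l * Real.exp (-(γ * S n))) ∂μ)
      (∫ γ, Real.exp (-(γ * (S n - t))) ∂μ) := by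
    have ht0 := ht.1
    refine hasSum_integral_of_ae_nonneg (fun l => by fun_prop) ?_ ?_ (.of_forall fun γ => ?_)
    · filter_upwards [hnonneg] with γ hγ l
      positivity
    · refine Integrable.of_bound (by fun_prop) 1 ?_
      filter_upwards [hnonneg] with γ hγ
      rw [Real.norm_of_nonneg (Real.exp_pos _).le, Real.exp_le_one_iff]
      have := mul_nonneg hγ (sub_pos.2 ht.2).le
      linarith
    · have := (NormedSpace.expSeries_div_hasSum_exp (t * γ)).mul_right (Real.exp (-(γ * S n)))
      rw [← Real.exp_eq_exp_ℝ, ← Real.exp_add] at this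
      have harg : t * γ + -(γ * S n) = -(γ * (S n - t)) := by ring
      rw [harg] at this
      exact this.congr_fun fun l => by rw [mul_pow]; ring
  have hU' := hν n t ⟨ht.1.le, ht.2⟩
  rw [hlaplace] at hU'
  have := hU'.sub hexp
  rw [sub_self] at this
  exact this.congr_fun fun l => by rw [integral_const_mul]; ring

lemma risingFac_succ (x : ℝ) (j : ℕ) : risingFac x (j + 1) = risingFac x j * (x + j) :=
  Finset.prod_range_succ _ _

lemma risingFac_pos {x : ℝ} (hx : 0 < x) (j : ℕ) : 0 < risingFac x j :=
  Finset.prod_pos fun _ _ => by positivity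

/-- The exponential rate of the weights `VIBP α θ γ (n + 1)`. -/
noncomputable def ibpRate (α θ : ℝ) (n : ℕ) : ℝ :=
  ∑ i ∈ Finset.range (n + 1), risingFac (α + θ) i / risingFac (1 + θ) i

/-- The normalization turning `VIBP α θ γ (n + 1) k` into a derivative of `exp (-γ s)`. -/
noncomputable def ibpScale (θ : ℝ) (n k : ℕ) : ℝ := k ! * risingFac (θ + 1) n ^ k

lemma ibpScale_pos {θ : ℝ} (hθ : 0 < θ + 1) (n k : ℕ) : 0 < ibpScale θ n k := by
  have := risingFac_pos hθ n
  unfold ibpScale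
  positivity

lemma ibpRate_zero (α θ : ℝ) : ibpRate α θ 0 = 1 := by simp [ibpRate, risingFac]

lemma ibpRate_succ_sub (α θ : ℝ) (n : ℕ) :
    ibpRate α θ (n + 1) - ibpRate α θ n = risingFac (θ + α) (n + 1) / risingFac (θ + 1) (n + 1) := by
  rw [ibpRate, ibpRate, Finset.sum_range_succ _ (n + 1), add_sub_cancel_left, add_comm α,
    add_comm 1]

lemma ibpRate_monotone {α θ : ℝ} (hα : 0 < θ + α) (hθ : 0 < θ + 1) :
    Monotone (ibpRate α θ) :=
  monotone_nat_of_le_succ fun n => by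
    rw [← sub_nonneg, ibpRate_succ_sub]
    exact (div_pos (risingFac_pos hα _) (risingFac_pos hθ _)).le

lemma tendsto_ibpRate {α θ : ℝ} (hα0 : 0 ≤ α) (hα : 0 < θ + α) (hθ : 0 < θ + 1) :
    Tendsto (ibpRate α θ) atTop atTop := by
  have hlower : ∀ i : ℕ, (θ + α) / (θ + 1) * (θ + 1) ≤
      risingFac (α + θ) (i + 1) / risingFac (1 + θ) (i + 1) * (θ + 1 + i) := by
    intro i
    induction i with
    | zero => simp [risingFac, add_comm]
    | succ i ih =>
      refine ih.trans ?_
      have hA := risingFac_pos (add_comm θ α ▸ hα) (i + 1)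
      have hR := risingFac_pos (add_comm θ 1 ▸ hθ) (i + 1)
      have hi : 0 < θ + 1 + ((i + 1 : ℕ) : ℝ) := by positivity
      rw [risingFac_succ _ (i + 1), risingFac_succ _ (i + 1), add_comm 1 θ, mul_div_mul_comm,
        mul_assoc, div_mul_cancel₀ _ hi.ne']
      refine mul_le_mul_of_nonneg_left ?_ (by rw [add_comm θ 1]; positivity)
      push_cast
      linarith
  have hterm : ∀ i : ℕ, (θ + α) / (θ + 2) * (1 / ((i : ℝ) + 1)) ≤
      risingFac (α + θ) (i + 1) / risingFac (1 + θ) (i + 1) := by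
    intro i
    have hi : 0 < θ + 1 + (i : ℝ) := by positivity
    have := hlower i
    rw [div_mul_cancel₀ _ hθ.ne', ← div_le_iff₀ hi] at this
    refine le_trans ?_ this
    rw [div_mul_div_comm, mul_one]
    have h2 : 0 ≤ (θ + 1) * (i : ℝ) := by positivity
    exact div_le_div_of_nonneg_left hα.le hi (by nlinarith)
  have hdiv := (Real.tendsto_sum_range_one_div_nat_succ_atTop).const_mul_atTop
    (div_pos hα (by linarith : 0 < θ + 2))
  refine tendsto_atTop_mono (fun n => ?_) hdiv
  rw [Finset.mul_sum, ibpRate, Finset.sum_range_succ']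
  refine (Finset.sum_le_sum fun i _ => hterm i).trans ?_
  simp [risingFac]

lemma ibpScale_mul_VIBP {α θ : ℝ} (hθ : 0 < θ + 1) (γ : ℝ) (n k : ℕ) :
    ibpScale θ n k * VIBP α θ γ (n + 1) k = γ ^ k * Real.exp (-(γ * ibpRate α θ n)) := by
  have hR := risingFac_pos hθ n
  have hexp : ∑ i ∈ Finset.Icc 1 (n + 1),
      γ * risingFac (α + θ) (i - 1) / risingFac (1 + θ) (i - 1) = γ * ibpRate α θ n := by
    rw [ibpRate, Finset.mul_sum, ← Finset.Ico_add_one_right_eq_Icc, Finset.sum_Ico_eq_sum_range]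
    exact Finset.sum_congr rfl fun i _ => by rw [add_tsub_cancel_left, mul_div_assoc]
  rw [VIBP, hexp, ibpScale, add_tsub_cancel_right, div_pow]
  have := Nat.factorial_ne_zero k
  field_simp

lemma ibpScale_mul_consistency_term {α θ : ℝ} (hθ : 0 < θ + 1) (n k j : ℕ) (w : ℝ) :
    ibpScale θ n k * (((k + j).choose j : ℝ) * risingFac (θ + α) (n + 1) ^ j *
        (θ + ((n + 1 : ℕ) : ℝ)) ^ k * w) =
      (ibpRate α θ (n + 1) - ibpRate α θ n) ^ j / j ! * (ibpScale θ (n + 1) (k + j) * w) := by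
  have hR := risingFac_pos hθ n
  have hn : 0 < θ + 1 + (n : ℝ) := by positivity
  have hcast : θ + ((n + 1 : ℕ) : ℝ) = θ + 1 + n := by push_cast; ring
  rw [ibpRate_succ_sub, ibpScale, ibpScale, ← Nat.choose_symm_add, Nat.cast_add_choose, hcast,
    risingFac_succ (θ + 1), div_pow, pow_add, mul_pow, mul_pow]
  have := Nat.factorial_ne_zero k
  have := Nat.factorial_ne_zero j
  field_simp

/-- The Indian Buffet Process weights satisfy the consistency recursion. -/
lemma hasSum_VIBP {α θ : ℝ} (hθ : 0 < θ + 1) (γ : ℝ) (n k : ℕ) :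
    HasSum (fun j => ((k + j).choose j : ℝ) * risingFac (θ + α) (n + 1) ^ j *
        (θ + ((n + 1 : ℕ) : ℝ)) ^ k * VIBP α θ γ (n + 1 + 1) (k + j))
      (VIBP α θ γ (n + 1) k) := by
  rw [← hasSum_mul_left_iff (ibpScale_pos hθ n k).ne']
  simp_rw [ibpScale_mul_consistency_term hθ, ibpScale_mul_VIBP hθ]
  have h := (NormedSpace.expSeries_div_hasSum_exp
    ((ibpRate α θ (n + 1) - ibpRate α θ n) * γ)).mul_left
    (γ ^ k * Real.exp (-(γ * ibpRate α θ (n + 1))))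
  rw [← Real.exp_eq_exp_ℝ, mul_assoc, ← Real.exp_add] at h
  have harg : -(γ * ibpRate α θ (n + 1)) + (ibpRate α θ (n + 1) - ibpRate α θ n) * γ =
    -(γ * ibpRate α θ n) := by ring
  rw [harg] at h
  exact h.congr_fun fun j => by rw [mul_pow]; ring

lemma hasSum_VIBP_one (α θ γ : ℝ) : HasSum (fun j => VIBP α θ γ 1 j) 1 := by
  have h := (NormedSpace.expSeries_div_hasSum_exp γ).mul_right (Real.exp (-γ))
  rw [← Real.exp_eq_exp_ℝ, ← Real.exp_add, add_neg_cancel, Real.exp_zero] at h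
  exact h.congr_fun fun j => by simp [VIBP, risingFac]; ring

lemma continuous_VIBP (α θ : ℝ) (n k : ℕ) : Continuous fun γ => VIBP α θ γ n k := by
  unfold VIBP
  fun_prop

lemma VIBP_nonneg {α θ γ : ℝ} (hθ : 0 < θ + 1) (hγ : 0 ≤ γ) (n k : ℕ) : 0 ≤ VIBP α θ γ n k := by
  have := risingFac_pos hθ (n - 1)
  unfold VIBP
  positivity

lemma VIBP_succ_le {α θ γ : ℝ} (hα : 0 < θ + α) (hθ : 0 < θ + 1) (hγ : 0 ≤ γ) (n k : ℕ) :
    VIBP α θ γ (n + 1) k ≤ k ! / ibpScale θ n k := by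
  rw [le_div_iff₀' (ibpScale_pos hθ n k), ibpScale_mul_VIBP hθ]
  have h1 : (1 : ℝ) ≤ ibpRate α θ n :=
    ibpRate_zero α θ ▸ ibpRate_monotone hα hθ n.zero_le
  have h2 : Real.exp (-(γ * ibpRate α θ n)) ≤ Real.exp (-γ) :=
    Real.exp_le_exp.2 (by nlinarith)
  have h3 : γ ^ k ≤ k ! * Real.exp γ := by
    have := Real.pow_div_factorial_le_exp γ hγ k
    rwa [div_le_iff₀' (by positivity)] at this
  calc _ ≤ (k ! * Real.exp γ) * Real.exp (-γ) := by gcongr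
    _ = k ! := by rw [mul_assoc, ← Real.exp_add]; simp

lemma integrable_VIBP {α θ : ℝ} (hα : 0 < θ + α) (hθ : 0 < θ + 1) {μ : Measure ℝ}
    [IsFiniteMeasure μ] (hμ : ∀ᵐ γ ∂μ, 0 ≤ γ) (n k : ℕ) :
    Integrable (fun γ => VIBP α θ γ (n + 1) k) μ := by
  refine Integrable.of_bound (continuous_VIBP α θ _ k).aestronglyMeasurable (k ! / ibpScale θ n k) ?_
  filter_upwards [hμ] with γ hγ
  rw [Real.norm_of_nonneg (VIBP_nonneg hθ hγ _ _)]
  exact VIBP_succ_le hα hθ hγ n k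

/-- Mixtures of Indian Buffet Process weights are solutions. -/
lemma isSolution_of_mixture {α θ : ℝ} (hα : 0 < θ + α) (hθ : 0 < θ + 1) {V : ℕ → ℕ → ℝ}
    {μ : Measure ℝ} [IsProbabilityMeasure μ] (hμ : ∀ᵐ γ ∂μ, 0 ≤ γ)
    (hV : ∀ n, 1 ≤ n → ∀ k, V n k = ∫ γ, VIBP α θ γ n k ∂μ) : IsSolution α θ V := by
  refine ⟨?_, fun n hn k => ?_⟩
  · have h := hasSum_integral_of_ae_nonneg
      (fun j => (continuous_VIBP α θ 1 j).aestronglyMeasurable) (μ := μ) (h := fun _ => 1)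
      (by filter_upwards [hμ] with γ hγ j using VIBP_nonneg hθ hγ 1 j) (integrable_const 1)
      (.of_forall fun γ => hasSum_VIBP_one α θ γ)
    rw [integral_const, probReal_univ, one_smul] at h
    exact h.congr_fun fun j => hV 1 le_rfl j
  · obtain ⟨n, rfl⟩ := Nat.exists_eq_add_of_le' hn
    have h := hasSum_integral_of_ae_nonneg (μ := μ)
      (fun j => ((continuous_VIBP α θ (n + 1 + 1) (k + j)).const_mul
        (((k + j).choose j : ℝ) * risingFac (θ + α) (n + 1) ^ j *
        (θ + ((n + 1 : ℕ) : ℝ)) ^ k)).aestronglyMeasurable)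
      (by
        filter_upwards [hμ] with γ hγ j
        have h1 := VIBP_nonneg (α := α) hθ hγ (n + 1 + 1) (k + j)
        have h2 := risingFac_pos hα (n + 1)
        have h3 : 0 < θ + ((n + 1 : ℕ) : ℝ) := by push_cast; linarith [n.cast_nonneg (α := ℝ)]
        positivity)
      (integrable_VIBP hα hθ hμ n k) (.of_forall fun γ => hasSum_VIBP hθ γ n k)
    rw [hV (n + 1) hn]
    exact h.congr_fun fun j => by rw [hV _ (by omega), integral_const_mul]

/-- Every solution is a mixture of Indian Buffet Process weights. -/
lemma IsSolution.exists_mixture {α θ : ℝ} (hα0 : 0 ≤ α) (hα : 0 < θ + α) (hθ : 0 < θ + 1)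
    {V : ℕ → ℕ → ℝ} (hVnonneg : ∀ n k, 0 ≤ V n k) (hV : IsSolution α θ V) :
    ∃ μ : Measure ℝ, IsProbabilityMeasure μ ∧ μ (Iio 0) = 0 ∧
      ∀ n, 1 ≤ n → ∀ k, V n k = ∫ γ, VIBP α θ γ n k ∂μ := by
  have hmono := ibpRate_monotone hα hθ
  obtain ⟨μ, hprob, hμ, h⟩ := exists_measure_eq_integral_pow_mul_exp
    (S := ibpRate α θ) (U := fun n k => ibpScale θ n k * V (n + 1) k) hmono
    (fun n => zero_lt_one.trans_le (ibpRate_zero α θ ▸ hmono n.zero_le))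
    (tendsto_ibpRate hα0 hα hθ)
    (fun n k => mul_nonneg (ibpScale_pos hθ n k).le (hVnonneg _ _))
    (hV.1.congr_fun fun l => by
      have := Nat.factorial_ne_zero l
      simp [ibpRate_zero, ibpScale, risingFac]
      field_simp)
    (fun n k => ((hV.2 (n + 1) n.succ_pos k).mul_left (ibpScale θ n k)).congr_fun fun j =>
      (ibpScale_mul_consistency_term hθ n k j _).symm)
  refine ⟨μ, hprob, hμ, fun n hn k => ?_⟩
  obtain ⟨n, rfl⟩ := Nat.exists_eq_add_of_le' hn
  refine mul_left_cancel₀ (ibpScale_pos hθ n k).ne' ((h n k).trans ?_)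
  simp_rw [← integral_const_mul, ibpScale_mul_VIBP hθ]

/-- Theorem 1.1, case `0 < α < 1`: solutions are exactly mixtures of 3-parameter
IBP weights over `γ`. -/
theorem stmt_4
    (α θ : ℝ) (hα0 : 0 < α) (hα1 : α < 1) (hθ : -α < θ)
    (V : ℕ → ℕ → ℝ) (hVnonneg : ∀ n k, 0 ≤ V n k) :
    IsSolution α θ V ↔
      ∃ μ : Measure ℝ, IsProbabilityMeasure μ ∧ μ (Set.Iio 0) = 0 ∧
        ∀ n : ℕ, 1 ≤ n → ∀ k : ℕ, V n k = ∫ γ, VIBP α θ γ n k ∂μ := by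
  have hα : 0 < θ + α := by linarith
  have hθ' : 0 < θ + 1 := by linarith
  refine ⟨fun h => h.exists_mixture hα0.le hα hθ' hVnonneg, ?_⟩
  rintro ⟨μ, hprob, hμ, hV⟩
  refine isSolution_of_mixture hα hθ' ?_ hV
  rw [ae_iff]
  simpa [Set.Iio] using hμ
end

section
/- For all real numbers α and θ and all integers n, m with 1 ≤ n ≤ m, it holds that α · Σ_{i=1}^{m−n} (α+θ)_{m−i↑} (θ+m−1)_{i−1↓} = (α+θ)_{m↑} − (θ+n)_{m−n↑} (α+θ)_{n↑}. (Summation identity used in the proof of Proposition 2.3; equivalently, for α ≠ 0, Σ_{i=1}^{m−n} (α+θ)_{m−i↑} (θ+m−1)_{i−1↓} = Γ(α+θ+m)/(α Γ(α+θ)) − Γ(θ+m) Γ(α+θ+n)/(α Γ(α+θ) Γ(θ+n)).) -/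
open scoped BigOperators

/-- Falling factorial `(x)_{j↓} = x(x-1)⋯(x-j+1)`. -/
noncomputable def fallingFac (x : ℝ) (j : ℕ) : ℝ :=
  ∏ i ∈ Finset.range j, (x - i)

theorem fallingFac_add_sub_one (x : ℝ) (k : ℕ) : fallingFac (x + k - 1) k = risingFac x k := by
  unfold fallingFac risingFac
  rw [← Finset.prod_range_reflect]
  refine Finset.prod_congr rfl fun i hi => ?_
  have hi' : i + 1 ≤ k := Finset.mem_range.mp hi
  rw [Nat.sub_sub, Nat.cast_sub (by omega)]
  push_cast
  ring

/-- Telescoping sum of mixed products of rising and falling factorials. -/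
theorem mul_sum_risingFac_mul_fallingFac (α θ : ℝ) (m k : ℕ) (hk : k ≤ m) :
    α * ∑ i ∈ Finset.Icc 1 k,
        risingFac (α + θ) (m - i) * fallingFac (θ + (m : ℝ) - 1) (i - 1) =
      risingFac (α + θ) m - fallingFac (θ + (m : ℝ) - 1) k * risingFac (α + θ) (m - k) := by
  induction k with
  | zero => simp [fallingFac]
  | succ k ih =>
    rw [Finset.sum_Icc_succ_top (by omega), mul_add, ih (by omega)]
    obtain ⟨d, rfl⟩ := Nat.exists_eq_add_of_le hk
    have h₁ : k + 1 + d - k = d + 1 := by omega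
    have h₂ : k + 1 + d - (k + 1) = d := by omega
    rw [h₁, h₂, Nat.add_sub_cancel]
    simp only [risingFac, fallingFac, Finset.prod_range_succ]
    push_cast
    ring

/-- Summation identity used in the proof of Proposition 2.3. -/
theorem stmt_10
    (α θ : ℝ) (n m : ℕ) (hn : 1 ≤ n) (hnm : n ≤ m) :
    α * ∑ i ∈ Finset.Icc 1 (m - n),
        risingFac (α + θ) (m - i) * fallingFac (θ + (m : ℝ) - 1) (i - 1) =
      risingFac (α + θ) m - risingFac (θ + (n : ℝ)) (m - n) * risingFac (α + θ) n := by
  rw [mul_sum_risingFac_mul_fallingFac α θ m (m - n) (Nat.sub_le m n), Nat.sub_sub_self hnm,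
    ← fallingFac_add_sub_one (θ + n), Nat.cast_sub hnm, add_assoc θ, add_sub_cancel]
end

section
/- Let f, g, h : ℕ → ℝ be such that f(m) → ∞ as m → ∞, g(m)/f(m) → ∞, and h(m)/f(m) → 1. Then for every k ∈ ℕ₀ and all real p > q, the sequence (g(m)/f(m))^k · ((h(m)−p)/(h(m)−q))^{g(m)} converges to 0 as m → ∞ (the bases are eventually positive, and the powers are real powers). (Lemma A.5.) -/
open Filter

/-- Lemma A.5. -/
theorem stmt_15
    (f g h : ℕ → ℝ)
    (hf : Tendsto f atTop atTop)
    (hgf : Tendsto (fun m => g m / f m) atTop atTop)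
    (hhf : Tendsto (fun m => h m / f m) atTop (nhds 1))
    (k : ℕ) (p q : ℝ) (hpq : q < p) :
    Tendsto (fun m => (g m / f m) ^ k * ((h m - p) / (h m - q)) ^ (g m)) atTop
      (nhds 0) := by
  have hc : 0 < (p - q) / 2 := by linarith
  have key : Tendsto (fun m => (g m / f m) ^ k * Real.exp (-((p - q) / 2) * (g m / f m)))
      atTop (nhds 0) := by
    have := (tendsto_rpow_mul_exp_neg_mul_atTop_nhds_zero (k : ℝ) _ hc).comp hgf
    simpa only [Function.comp_def, Real.rpow_natCast] using this
  have hev : ∀ᶠ m in atTop, 0 ≤ g m / f m ∧ 0 ≤ (h m - p) / (h m - q) ∧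
      ((h m - p) / (h m - q)) ^ (g m) ≤ Real.exp (-((p - q) / 2) * (g m / f m)) := by
    filter_upwards [hf.eventually_gt_atTop 0, hf.eventually_gt_atTop (2 * p),
      hf.eventually_gt_atTop (-2 * q), hgf.eventually_gt_atTop 0,
      hhf.eventually_lt_const (show (1 : ℝ) < 3 / 2 by norm_num),
      hhf.eventually_const_lt (show (1 / 2 : ℝ) < 1 by norm_num)]
      with m hf0 hfp hfq hgf0 hu hl
    rw [div_lt_iff₀ hf0] at hu
    rw [lt_div_iff₀ hf0] at hl
    have hg0 : 0 < g m := (div_pos_iff_of_pos_right hf0).1 hgf0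
    have hhq : 0 < h m - q := by linarith
    have hb0 : 0 ≤ (h m - p) / (h m - q) := div_nonneg (by linarith) hhq.le
    refine ⟨hgf0.le, hb0, ?_⟩
    have hb : (h m - p) / (h m - q) ≤ Real.exp (-((p - q) / (2 * f m))) := by
      have h1 : (h m - p) / (h m - q) = 1 - (p - q) / (h m - q) := by
        field_simp
        ring
      have h2 : (p - q) / (2 * f m) ≤ (p - q) / (h m - q) :=
        div_le_div_of_nonneg_left (by linarith) hhq (by linarith)
      have h3 := Real.one_sub_le_exp_neg ((p - q) / (2 * f m))
      linarith
    calc ((h m - p) / (h m - q)) ^ (g m)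
        ≤ Real.exp (-((p - q) / (2 * f m))) ^ (g m) := Real.rpow_le_rpow hb0 hb hg0.le
      _ = Real.exp (-((p - q) / 2) * (g m / f m)) := by
        rw [← Real.exp_mul]
        congr 1
        field_simp
  refine squeeze_zero' ?_ ?_ key
  · filter_upwards [hev] with m ⟨h1, h2, _⟩
    exact mul_nonneg (pow_nonneg h1 k) (Real.rpow_nonneg h2 _)
  · filter_upwards [hev] with m ⟨h1, _, h3⟩
    exact mul_le_mul_of_nonneg_left h3 (pow_nonneg h1 k)
end
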